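/- Let p be a prime and q = p^4. Let k be a divisor of 4, v ≥ 1 a divisor of p^k − 1, m ≥ 1 with mk dividing 4, and let U = {c ∈ 𝔽_{p^4} : c^{p^{mk}} = c} be the subfield 𝔽_{p^{mk}} of 𝔽_{p^4}; assume #U^v > 2. Let e be the smallest positive integer such that s^{p^e} = s for all s ∈ U^v, and set t = v·(p^e − 1)/(p^{mk} − 1) (a positive integer). Then 𝒫(U^v, p^4) = {f^t : f ∈ 𝒫(𝔽_{p^e}, p^4)}. -/

import Mathlib

open Polynomial

/-- The value set of a polynomial over a finite field. -/
def valueSet {F : Type*} [Field F] [Fintype F] [DecidableEq F] (f : F[X]) : Finset F :=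
  Finset.image (fun a => f.eval a) Finset.univ

/-- A minimal value set polynomial (MVSP): a nonconstant polynomial whose value set has
the minimal possible size `⌊(q-1)/deg f⌋ + 1`. -/
def IsMVSP {F : Type*} [Field F] [Fintype F] [DecidableEq F] (f : F[X]) : Prop :=
  0 < f.natDegree ∧ (valueSet f).card = (Fintype.card F - 1) / f.natDegree + 1

/-- `MVSPset S` is the set `𝒫(S, q)` of all MVSPs with value set `S`. -/
def MVSPset {F : Type*} [Field F] [Fintype F] [DecidableEq F] (S : Finset F) : Set F[X] :=
  {f | IsMVSP f ∧ valueSet f = S}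

/-- `U` is a subspace over the subfield `{c : c ^ r = c}` (with `r = p ^ k`):
an additive subgroup closed under multiplication by elements of that subfield. -/
def IsSubspaceOver {F : Type*} [Field F] (r : ℕ) (U : Set F) : Prop :=
  (0 : F) ∈ U ∧ (∀ x ∈ U, ∀ y ∈ U, x + y ∈ U) ∧ (∀ x ∈ U, -x ∈ U) ∧
    (∀ c : F, c ^ r = c → ∀ x ∈ U, c * x ∈ U)

/-- An `r`-linearized polynomial (with `r = q` or `r = p ^ k`): of the form `Σ aᵢ x ^ (r ^ i)`. -/
def IsLinearized {F : Type*} [Field F] (r : ℕ) (M : F[X]) : Prop :=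
  ∃ (s : ℕ) (a : ℕ → F), M = ∑ i ∈ Finset.range (s + 1), C (a i) * X ^ r ^ i

lemma aux_prod_dvd {K : Type*} [Field K] (s : Finset K) (T : K[X])
    (h : ∀ a ∈ s, T.eval a = 0) : (∏ a ∈ s, (X - C a)) ∣ T := by
  apply Finset.prod_dvd_of_coprime
  · intro a _ b _ hab
    exact pairwise_coprime_X_sub_C (s := fun x : K => x) Function.injective_id hab
  · intro a ha
    exact dvd_iff_isRoot.mpr (h a ha)

lemma aux_card_le {K : Type*} [Field K] (s : Finset K) (T : K[X]) (hT : T ≠ 0)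
    (h : ∀ a ∈ s, T.eval a = 0) : s.card ≤ T.natDegree := by
  have h1 := natDegree_le_of_dvd (aux_prod_dvd s T h) hT
  rwa [natDegree_prod_of_monic _ _ (fun a _ => monic_X_sub_C a), Finset.sum_congr rfl
    (fun a _ => natDegree_X_sub_C a), Finset.sum_const, smul_eq_mul, mul_one] at h1

lemma aux_P {K : Type*} [Field K] [Fintype K] :
    (X ^ Fintype.card K - X : K[X]) = ∏ a : K, (X - C a) := by
  have hm : (X ^ Fintype.card K - X : K[X]).Monic := by
    apply monic_X_pow_sub
    rw [degree_X]
    exact_mod_cast Fintype.one_lt_card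
  have hd : (∏ a : K, (X - C a)) ∣ (X ^ Fintype.card K - X : K[X]) := by
    apply aux_prod_dvd
    intro a _
    simp [FiniteField.pow_card]
  refine (eq_of_monic_of_dvd_of_natDegree_le (monic_prod_of_monic _ _ fun a _ => monic_X_sub_C a)
    hm hd ?_).symm.symm
  rw [FiniteField.X_pow_card_sub_X_natDegree_eq K Fintype.one_lt_card,
    natDegree_prod_of_monic _ _ (fun a _ => monic_X_sub_C a), Finset.sum_congr rfl
    (fun a _ => natDegree_X_sub_C a), Finset.sum_const, smul_eq_mul, mul_one, Finset.card_univ]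

lemma aux_derivP {K : Type*} [Field K] [Fintype K] :
    derivative (X ^ Fintype.card K - X : K[X]) = -1 := by
  rw [derivative_sub, derivative_X_pow, FiniteField.cast_card_eq_zero]
  simp

lemma aux_ode {K : Type*} [Field K] [Fintype K] [DecidableEq K] (f : K[X]) (d : ℕ) (hd : 2 ≤ d)
    (hD : 0 < f.natDegree) (hDd : f.natDegree * d ≤ Fintype.card K - 1)
    (hf : ∀ a, f.eval a ^ (d + 1) = f.eval a) :
    f ^ (d + 1) - f = - (C (d : K) * (X ^ Fintype.card K - X) * derivative f) := by
  have hq : 0 < Fintype.card K := Fintype.card_pos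
  have hdvd : (X ^ Fintype.card K - X : K[X]) ∣ f ^ (d + 1) - f := by
    rw [aux_P]
    apply aux_prod_dvd
    intro a _
    simp [hf a]
  obtain ⟨M, hM⟩ := hdvd
  have hT : (f ^ (d + 1) - f).natDegree = (d + 1) * f.natDegree := by
    rw [natDegree_sub_eq_left_of_natDegree_lt] <;> rw [natDegree_pow]
    nlinarith
  have hT0 : f ^ (d + 1) - f ≠ 0 := by
    intro h
    rw [h] at hT
    simp at hT
    omega
  have hM0 : M ≠ 0 := by
    rintro rfl
    simp at hM
    exact hT0 hM
  have hdeg : (d + 1) * f.natDegree = Fintype.card K + M.natDegree := by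
    rw [← hT, hM, natDegree_mul (FiniteField.X_pow_card_sub_X_ne_zero K Fintype.one_lt_card) hM0,
      FiniteField.X_pow_card_sub_X_natDegree_eq K Fintype.one_lt_card]
  have hH : C (d : K) * derivative f + M = 0 := by
    by_contra hne
    have hev : ∀ a, f.eval a ≠ 0 → (C (d : K) * derivative f + M).eval a = 0 := by
      intro a ha
      have h1 := congrArg (fun g => (derivative g).eval a) hM
      simp only [derivative_mul, aux_derivP] at h1
      simp [FiniteField.pow_card, derivative_pow] at h1
      have h2 : f.eval a ^ d = 1 := by
        have := hf a
        rw [pow_succ] at this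
        exact mul_right_cancel₀ ha (by rw [this, one_mul])
      rw [h2] at h1
      simp
      linear_combination h1
    have h1 := aux_card_le (Finset.univ.filter fun a => f.eval a ≠ 0) _ hne
      (fun a ha => hev a (Finset.mem_filter.mp ha).2)
    have h2 := aux_card_le (Finset.univ.filter fun a => f.eval a = 0) f
      (by rintro rfl; simp at hD) (fun a ha => (Finset.mem_filter.mp ha).2)
    have h3 := Finset.card_filter_add_card_filter_not (s := (Finset.univ : Finset K)) (fun a => f.eval a = 0)
    rw [Finset.card_univ] at h3
    have h4 : (C (d : K) * derivative f + M).natDegree ≤ f.natDegree - 1 := by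
      apply natDegree_add_le_of_degree_le
      · exact (natDegree_C_mul_le _ _).trans (natDegree_derivative_le _)
      · have : (d + 1) * f.natDegree = f.natDegree * d + f.natDegree := by ring
        omega
    have : f.natDegree * 2 ≤ f.natDegree * d := Nat.mul_le_mul_left _ hd
    simp only [ne_eq] at h1
    omega
  rw [hM]
  linear_combination (X ^ Fintype.card K - X) * hH

lemma aux_root {K : Type*} [Field K] [Fintype K] (p : ℕ) [Fact p.Prime] [CharP K p] (f : K[X])
    (h : derivative f = 0) : ∃ g : K[X], f = g ^ p := by
  have hp : p ≠ 0 := (Fact.out : p.Prime).ne_zero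
  refine ⟨(contract p f).map (frobeniusEquiv K p).symm, ?_⟩
  conv_lhs => rw [← expand_contract p h hp]
  rw [← map_frobenius_expand (p := p), map_expand, map_map]
  congr 1
  conv_lhs => rw [← Polynomial.map_id (p := contract p f)]
  congr 1
  ext x
  exact ((frobeniusEquiv K p).apply_symm_apply x).symm

lemma aux_uniq {α : Type*} [CommMonoidWithZero α] [UniqueFactorizationMonoid α] (t : ℕ) (a : α)
    (ha : a ≠ 0)
    (h : ∀ π, Prime π → ∀ m ψ, 0 < m → a = π ^ m * ψ → ¬ π ∣ ψ → m = t) :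
    ∃ u b, IsUnit u ∧ a = u * b ^ t := by
  induction a using UniqueFactorizationMonoid.induction_on_coprime with
  | h0 => exact absurd rfl ha
  | h1 hx => exact ⟨_, 1, hx, by simp⟩
  | @hpr π i hπ =>
    rcases Nat.eq_zero_or_pos i with rfl | hi
    · exact ⟨1, 1, isUnit_one, by simp⟩
    · refine ⟨1, π, isUnit_one, ?_⟩
      rw [h π hπ i 1 hi (by simp) (fun h => hπ.not_isUnit (isUnit_of_dvd_one h)), one_mul]
  | @hcp x y hxy ihx ihy =>
    have hx0 := left_ne_zero_of_mul ha
    have hy0 := right_ne_zero_of_mul ha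
    obtain ⟨u, b, hu, rfl⟩ := ihx hx0 (by
      intro π hπ m ψ hm hx hψ
      refine h π hπ m (ψ * y) hm (by rw [hx, mul_assoc]) ?_
      intro h1
      rcases hπ.dvd_or_dvd h1 with h1 | h1
      · exact hψ h1
      · exact hπ.not_isUnit (hxy (hx ▸ (dvd_pow_self π hm.ne').mul_right ψ) h1))
    obtain ⟨w, c, hw, rfl⟩ := ihy hy0 (by
      intro π hπ m ψ hm hx hψ
      refine h π hπ m (ψ * (u * b ^ t)) hm (by rw [hx, mul_comm, mul_assoc]) ?_
      intro h1
      rcases hπ.dvd_or_dvd h1 with h1 | h1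
      · exact hψ h1
      · exact hπ.not_isUnit (hxy h1 (hx ▸ (dvd_pow_self π hm.ne').mul_right ψ)))
    refine ⟨u * w, b * c, hu.mul hw, ?_⟩
    rw [mul_pow]
    exact mul_mul_mul_comm _ _ _ _

lemma aux_start {K : Type*} [Field K] [Fintype K] [DecidableEq K] (p : ℕ) [Fact p.Prime] [CharP K p]
    (hcard : Fintype.card K = p ^ 4) (f : K[X]) (d : ℕ) (hd : 2 ≤ d)
    (hD : 0 < f.natDegree) (hDd : f.natDegree * d ≤ Fintype.card K - 1)
    (hf : ∀ a, f.eval a ^ (d + 1) = f.eval a) (hz : ∃ a, f.eval a = 0) (R : K[X])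
    (hR : R = ∏ a ∈ Finset.univ.filter (fun a => f.eval a = 0), (X - C a)) :
    ∃ B Z : K[X], R = B ^ p ^ 1 - X * Z ^ p ^ 1 ∧
      f ^ d * R = (B - X ^ p ^ (4 - 1) * Z) ^ p ^ 1 := by
  have hode := aux_ode f d hd hD hDd hf
  have hd0 : d ≠ 0 := by omega
  have hp : p.Prime := Fact.out
  set P : K[X] := X ^ Fintype.card K - X with hP
  have hP' : derivative P = -1 := aux_derivP
  have hPP : P = ∏ a : K, (X - C a) := aux_P
  have hP0 : P ≠ 0 := FiniteField.X_pow_card_sub_X_ne_zero K Fintype.one_lt_card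
  set R2 : K[X] := ∏ a ∈ Finset.univ.filter (fun a => ¬ f.eval a = 0), (X - C a) with hR2
  have hRR : P = R * R2 := by
    rw [hPP, hR, hR2, Finset.prod_filter_mul_prod_filter_not]
  have hRdeg : R.natDegree = (Finset.univ.filter (fun a => f.eval a = 0)).card := by
    rw [hR, natDegree_prod_of_monic _ _ (fun a _ => monic_X_sub_C a), Finset.sum_congr rfl
      (fun a _ => natDegree_X_sub_C a), Finset.sum_const, smul_eq_mul, mul_one]
  have hRpos : 0 < R.natDegree := by
    rw [hRdeg, Finset.card_pos]
    obtain ⟨a, ha⟩ := hz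
    exact ⟨a, by simp [ha]⟩
  have hRf : R ∣ f := by
    rw [hR]
    exact aux_prod_dvd _ _ (fun a ha => (Finset.mem_filter.mp ha).2)
  obtain ⟨G, hG⟩ := hRf
  have hR2f : R2 ∣ 1 - f ^ d := by
    apply aux_prod_dvd
    intro a ha
    have ha := (Finset.mem_filter.mp ha).2
    have h2 : f.eval a ^ d = 1 := by
      have := hf a
      rw [pow_succ] at this
      exact mul_right_cancel₀ ha (by rw [this, one_mul])
    simp [h2]
  obtain ⟨Z, hZ⟩ := hR2f
  have hR0 : R ≠ 0 := by
    rintro h; rw [h] at hRpos; simp at hRpos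
  have hR20 : R2 ≠ 0 := by
    intro h; rw [h, mul_zero] at hRR; exact hP0 hRR
  have hfd : (1 - f ^ d).natDegree = f.natDegree * d := by
    rw [natDegree_sub_eq_right_of_natDegree_lt] <;> rw [natDegree_pow]
    · ring
    · simp; exact ⟨by omega, hD⟩
  have hfd0 : 1 - f ^ d ≠ 0 := by
    intro h
    rw [h] at hfd
    simp at hfd
    omega
  have hZ0 : Z ≠ 0 := by
    rintro rfl
    rw [mul_zero] at hZ
    exact hfd0 hZ
  have hdegP : P.natDegree = Fintype.card K :=
    FiniteField.X_pow_card_sub_X_natDegree_eq K Fintype.one_lt_card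
  have hdegs : R.natDegree + R2.natDegree = Fintype.card K := by
    rw [← natDegree_mul hR0 hR20, ← hRR, hdegP]
  have hdegZ : f.natDegree * d = R2.natDegree + Z.natDegree := by
    rw [← natDegree_mul hR20 hZ0, ← hZ, hfd]
  have hq : 0 < Fintype.card K := Fintype.card_pos
  have hRZ : derivative R + Z = 0 := by
    have hdvd : R ∣ derivative R + Z := by
      conv_lhs => rw [hR]
      apply aux_prod_dvd
      intro a ha
      have ha := (Finset.mem_filter.mp ha).2
      have hRa : R.eval a = 0 := by
        rw [hR, eval_prod]
        exact Finset.prod_eq_zero (i := a) (by simp [ha]) (by simp)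
      have h1 := congrArg (fun g => g.eval a) hP'
      simp only [hRR, derivative_mul, eval_add, eval_mul, hRa, eval_neg, eval_one] at h1
      have h2 := congrArg (fun g => g.eval a) hZ
      simp [ha, hd0] at h2
      have h3 : R2.eval a ≠ 0 := by
        intro h; rw [h] at h2; simp at h2
      apply mul_left_cancel₀ h3
      rw [eval_add]
      linear_combination h1 - h2
    refine eq_zero_of_dvd_of_natDegree_lt hdvd ?_
    have : (derivative R + Z).natDegree ≤ R.natDegree - 1 := by
      apply natDegree_add_le_of_degree_le
      · exact natDegree_derivative_le _
      · omega
    omega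
  have hGZ : G * Z = C (d : K) * derivative f := by
    apply mul_left_cancel₀ hP0
    have e1 : f ^ (d + 1) = f ^ d * f := pow_succ _ _
    have : P * (G * Z) = f * (1 - f ^ d) := by
      rw [hZ, hRR]; linear_combination -(R2 * Z) * hG
    rw [this]
    linear_combination -hode + e1
  have hPZ : P * Z = (1 - f ^ d) * R := by rw [hZ, hRR]; ring
  have hZ' : derivative Z = 0 := by
    apply (mul_eq_zero.mp _).resolve_left hP0
    have h1 := congrArg derivative hPZ
    simp only [derivative_mul, hP', derivative_sub, derivative_one, derivative_pow] at h1
    have e1 : f ^ d = f ^ (d - 1) * f := by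
      rw [← pow_succ]; congr 1; omega
    rw [Polynomial.C_eq_natCast] at h1 hGZ
    have h2 : (d : K[X]) * f ^ (d - 1) * derivative f * R = f ^ d * Z := by
      rw [e1]
      linear_combination -f ^ (d - 1) * R * hGZ - f ^ (d - 1) * Z * hG
    linear_combination h1 - h2 + (1 - f ^ d) * hRZ
  have hB' : derivative (R + X * Z) = 0 := by
    simp [hZ']
    linear_combination hRZ
  obtain ⟨Z1, hZ1⟩ := aux_root p Z hZ'
  obtain ⟨B1, hB1⟩ := aux_root p _ hB'
  refine ⟨B1, Z1, ?_, ?_⟩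
  · rw [pow_one, ← hB1, ← hZ1]; ring
  · rw [pow_one, sub_pow_char, mul_pow, ← pow_mul, ← hB1, ← hZ1, ← pow_succ]
    have : p ^ (4 - 1 + 1) = Fintype.card K := by rw [hcard]
    rw [this]
    linear_combination hPZ - Z * hP

lemma aux_step {K : Type*} [Field K] [Fintype K] [DecidableEq K] (p : ℕ) [Fact p.Prime] [CharP K p]
    (f : K[X]) (d : ℕ) (hf0 : f ≠ 0) (hz : ∃ a, f.eval a = 0) (R : K[X])
    (hR : R = ∏ a ∈ Finset.univ.filter (fun a => f.eval a = 0), (X - C a))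
    (s : ℕ) (hs : 1 ≤ s) (hs4 : s < 4) (hds : ¬ d ∣ p ^ s - 1)
    (B Z : K[X]) (h1 : R = B ^ p ^ s - X * Z ^ p ^ s)
    (h2 : f ^ d * R = (B - X ^ p ^ (4 - s) * Z) ^ p ^ s) :
    ∃ B Z : K[X], R = B ^ p ^ (s + 1) - X * Z ^ p ^ (s + 1) ∧
      f ^ d * R = (B - X ^ p ^ (4 - (s + 1)) * Z) ^ p ^ (s + 1) := by
  have hp : p.Prime := Fact.out
  have hps : 2 ≤ p ^ s := hp.two_le.trans (Nat.le_self_pow (by omega) p)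
  have hRsep : R.Separable := by
    rw [hR]
    exact separable_prod_X_sub_C_iff'.mpr (fun x _ y _ h => h)
  have hRdeg : R.natDegree = (Finset.univ.filter (fun a => f.eval a = 0)).card := by
    rw [hR, natDegree_prod_of_monic _ _ (fun a _ => monic_X_sub_C a), Finset.sum_congr rfl
      (fun a _ => natDegree_X_sub_C a), Finset.sum_const, smul_eq_mul, mul_one]
  have hRpos : 0 < R.natDegree := by
    rw [hRdeg, Finset.card_pos]
    obtain ⟨a, ha⟩ := hz
    exact ⟨a, by simp [ha]⟩
  have hR0 : R ≠ 0 := by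
    rintro h; rw [h] at hRpos; simp at hRpos
  have hcop : IsCoprime B Z := by
    rw [← isRelPrime_iff_isCoprime]
    intro g hgB hgZ
    apply hRsep.squarefree
    have : g ^ p ^ s ∣ R := by
      rw [h1]
      exact dvd_sub (pow_dvd_pow_of_dvd hgB _) ((pow_dvd_pow_of_dvd hgZ _).mul_left _)
    refine dvd_trans ?_ this
    rw [← sq]
    exact pow_dvd_pow _ hps
  have hZ0 : Z ≠ 0 := by
    rintro rfl
    have hB : IsUnit B := isCoprime_zero_right.mp hcop
    rw [zero_pow (by omega), mul_zero, sub_zero] at h1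
    have := natDegree_eq_zero_of_isUnit (hB.pow (p ^ s))
    rw [← h1] at this
    omega
  have hdB : p ^ s * B.natDegree ≤ R.natDegree ∧ 1 + p ^ s * Z.natDegree ≤ R.natDegree := by
    have e1 : (B ^ p ^ s).natDegree = p ^ s * B.natDegree := natDegree_pow _ _
    have e2 : (X * Z ^ p ^ s).natDegree = 1 + p ^ s * Z.natDegree := by
      rw [natDegree_mul X_ne_zero (pow_ne_zero _ hZ0), natDegree_X, natDegree_pow]
    have hne : p ^ s * B.natDegree ≠ 1 + p ^ s * Z.natDegree := by
      intro h
      have : p ^ s ∣ 1 := (Nat.dvd_add_left (dvd_mul_right _ _)).mp (h ▸ dvd_mul_right _ _)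
      have := Nat.le_of_dvd one_pos this
      omega
    rcases lt_or_gt_of_ne hne with h | h
    · have := natDegree_sub_eq_right_of_natDegree_lt (p := B ^ p ^ s) (q := X * Z ^ p ^ s)
        (by rw [e1, e2]; exact h)
      rw [← h1, e2] at this
      omega
    · have := natDegree_sub_eq_left_of_natDegree_lt (p := B ^ p ^ s) (q := X * Z ^ p ^ s)
        (by rw [e1, e2]; exact h)
      rw [← h1, e1] at this
      omega
  set Q := B - X ^ p ^ (4 - s) * Z with hQ
  have hQ' : derivative Q = derivative B - X ^ p ^ (4 - s) * derivative Z := by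
    have : ((p ^ (4 - s) : ℕ) : K) = 0 := by
      rw [Nat.cast_pow, CharP.cast_eq_zero, zero_pow (by omega)]
    rw [hQ, derivative_sub, derivative_mul, derivative_X_pow, this]
    simp
  have hlhs : f ^ d * R ≠ 0 := mul_ne_zero (pow_ne_zero _ hf0) hR0
  have hQ0 : Q ≠ 0 := by
    intro h
    rw [h, zero_pow (by omega)] at h2
    exact hlhs h2
  have hW : Z * derivative B - derivative Z * B = 0 := by
    have hdvd : R ∣ Z * derivative B - derivative Z * B := by
      conv_lhs => rw [hR]
      apply aux_prod_dvd
      intro a ha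
      have ha := (Finset.mem_filter.mp ha).2
      have hRa : R.eval a = 0 := by
        rw [hR, eval_prod]
        exact Finset.prod_eq_zero (i := a) (by simp [ha]) (by simp)
      have hRm : R.rootMultiplicity a = 1 := by
        apply le_antisymm
        · exact rootMultiplicity_le_one_of_separable hRsep a
        · exact (rootMultiplicity_pos hR0).mpr hRa
      have hm := congrArg (rootMultiplicity a) h2
      rw [rootMultiplicity_mul hlhs, hRm, ← count_roots, ← count_roots, roots_pow, roots_pow,
        Multiset.count_nsmul, Multiset.count_nsmul, count_roots, count_roots] at hm
      have hlt : 1 < Q.rootMultiplicity a := by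
        by_contra hle
        have : Q.rootMultiplicity a = 0 ∨ Q.rootMultiplicity a = 1 := by omega
        rcases this with h | h
        · rw [h] at hm; omega
        · rw [h] at hm
          exact hds ⟨f.rootMultiplicity a, by omega⟩
      have hr := (one_lt_rootMultiplicity_iff_isRoot hQ0).mp hlt
      have e1 : Q.eval a = 0 := hr.1
      have e2 : (derivative Q).eval a = 0 := hr.2
      have : Z * derivative B - derivative Z * B = Z * derivative Q - derivative Z * Q := by
        rw [hQ', hQ]; ring
      rw [this]
      simp [e1, e2]
    refine eq_zero_of_dvd_of_natDegree_lt hdvd ?_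
    have : (Z * derivative B - derivative Z * B).natDegree ≤ Z.natDegree + B.natDegree := by
      refine (natDegree_sub_le_of_le (m := Z.natDegree + B.natDegree)
        (n := Z.natDegree + B.natDegree) ?_ ?_).trans (max_self _).le
      · refine natDegree_mul_le.trans ?_
        have := natDegree_derivative_le B
        omega
      · refine natDegree_mul_le.trans ?_
        have := natDegree_derivative_le Z
        omega
    refine lt_of_le_of_lt this ?_
    nlinarith [hdB.1, hdB.2]
  have hZ' : derivative Z = 0 := by
    have : Z ∣ derivative Z * B := ⟨derivative B, by linear_combination -hW⟩
    have := hcop.symm.dvd_of_dvd_mul_right this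
    by_contra hne
    have h3 := natDegree_le_of_dvd this hne
    have h4 : Z.natDegree ≠ 0 := by
      intro h
      rw [eq_C_of_natDegree_eq_zero h] at hne
      simp at hne
    have := natDegree_derivative_lt h4
    omega
  have hB' : derivative B = 0 := by
    rw [hZ', zero_mul, sub_zero] at hW
    exact (mul_eq_zero.mp hW).resolve_left hZ0
  obtain ⟨Z1, hZ1⟩ := aux_root p Z hZ'
  obtain ⟨B1, hB1⟩ := aux_root p _ hB'
  refine ⟨B1, Z1, ?_, ?_⟩
  · rw [h1, hB1, hZ1, ← pow_mul, ← pow_mul, pow_succ' p s]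
  · rw [h2, hQ, pow_succ' p s, pow_mul _ p]
    congr 1
    rw [sub_pow_char, mul_pow, ← pow_mul, ← hB1, ← hZ1, ← pow_succ]
    congr 4
    omega

lemma aux_fin {K : Type*} [Field K] [Fintype K] [DecidableEq K] (p : ℕ) [Fact p.Prime] [CharP K p]
    (hcard : Fintype.card K = p ^ 4) (f : K[X]) (d t e : ℕ) (hd : 2 ≤ d)
    (hD : 0 < f.natDegree) (hDd : f.natDegree * d ≤ Fintype.card K - 1) 
    (hz : ∃ a, f.eval a = 0) (R : K[X])
    (hR : R = ∏ a ∈ Finset.univ.filter (fun a => f.eval a = 0), (X - C a))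
    (he : e = 2 ∨ e = 4) (htd : t * d = p ^ e - 1) (B Z : K[X])
    (h1 : R = B ^ p ^ e - X * Z ^ p ^ e)
    (h2 : f ^ d * R = (B - X ^ p ^ (4 - e) * Z) ^ p ^ e) :
    ∃ (c : K) (g : K[X]), f = C c * g ^ t := by
  have hp : p.Prime := Fact.out
  have he0 : e ≠ 0 := by omega
  have hpe : 2 ≤ p ^ e := hp.two_le.trans (Nat.le_self_pow he0 p)
  have hf0 : f ≠ 0 := by rintro rfl; simp at hD
  have ht0 : 0 < t := by
    rcases Nat.eq_zero_or_pos t with h | h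
    · rw [h] at htd; omega
    · exact h
  have hRsep : R.Separable := by
    rw [hR]
    exact separable_prod_X_sub_C_iff'.mpr (fun x _ y _ h => h)
  have hRdeg : R.natDegree = (Finset.univ.filter (fun a => f.eval a = 0)).card := by
    rw [hR, natDegree_prod_of_monic _ _ (fun a _ => monic_X_sub_C a), Finset.sum_congr rfl
      (fun a _ => natDegree_X_sub_C a), Finset.sum_const, smul_eq_mul, mul_one]
  have hRpos : 0 < R.natDegree := by
    rw [hRdeg, Finset.card_pos]
    obtain ⟨a, ha⟩ := hz
    exact ⟨a, by simp [ha]⟩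
  have hR0 : R ≠ 0 := by
    rintro h; rw [h] at hRpos; simp at hRpos
  have hlhs : f ^ d * R ≠ 0 := mul_ne_zero (pow_ne_zero _ hf0) hR0
  have hcop : Nat.Coprime (p ^ e) d := by
    apply Nat.Coprime.pow_left
    rw [hp.coprime_iff_not_dvd]
    intro h
    have h3 : p ∣ t * d := h.mul_left _
    have h4 : p ∣ p ^ e := dvd_pow_self p he0
    rw [htd] at h3
    have := (Nat.dvd_sub_iff_right (by omega) h4).mp h3
    exact hp.one_lt.ne' (Nat.dvd_one.mp this)
  have main : f.natDegree < t * R.natDegree + p ^ e → ∃ (c : K) (g : K[X]), f = C c * g ^ t := by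
    intro hlt
    set Q := B - X ^ p ^ (4 - e) * Z with hQ
    have hRQ : R ∣ Q := by
      have : R ∣ Q ^ p ^ e := h2 ▸ dvd_mul_left _ _
      exact (hRsep.squarefree.dvd_pow_iff_dvd (by omega)).mp this
    obtain ⟨S, hS⟩ := hRQ
    have h3 : f ^ d = (R ^ t) ^ d * S ^ p ^ e := by
      apply mul_right_cancel₀ hR0
      rw [h2, hS, ← pow_mul, htd, mul_pow]
      have : R ^ p ^ e = R ^ (p ^ e - 1) * R := by rw [← pow_succ]; congr 1; omega
      rw [this]; ring
    have h4 : R ^ t ∣ f := by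
      have : (R ^ t) ^ d ∣ f ^ d := ⟨_, h3⟩
      exact (IsIntegrallyClosed.pow_dvd_pow_iff (by omega)).mp this
    obtain ⟨E, hE⟩ := h4
    have hE0 : E ≠ 0 := by rintro rfl; simp at hE; exact hf0 hE
    have h5 : E ^ d = S ^ p ^ e := by
      apply mul_left_cancel₀ (pow_ne_zero d (pow_ne_zero t hR0))
      rw [← h3, hE, mul_pow]
    have h6 : d * E.natDegree = p ^ e * S.natDegree := by
      rw [← natDegree_pow, h5, natDegree_pow]
    have h7 : p ^ e ∣ E.natDegree := hcop.dvd_of_dvd_mul_left ⟨_, h6⟩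
    have h8 : f.natDegree = t * R.natDegree + E.natDegree := by
      conv_lhs => rw [hE]
      rw [natDegree_mul (pow_ne_zero t hR0) hE0, natDegree_pow]
    have h9 : E.natDegree = 0 := Nat.eq_zero_of_dvd_of_lt h7 (by omega)
    refine ⟨E.coeff 0, R, ?_⟩
    rw [← eq_C_of_natDegree_eq_zero h9, mul_comm]
    exact hE
  rcases he with rfl | rfl
  · have hq : p ^ 4 = p ^ 2 * p ^ 2 := by ring
    have hDle : f.natDegree ≤ t * (p ^ 2 + 1) := by
      apply Nat.le_of_mul_le_mul_right _ (by omega : 0 < d)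
      refine hDd.trans ?_
      rw [hcard, hq]
      have : t * (p ^ 2 + 1) * d = (t * d) * (p ^ 2 + 1) := by ring
      rw [this, htd]
      obtain ⟨m, hm⟩ : ∃ m, p ^ 2 = m + 1 := ⟨p ^ 2 - 1, by omega⟩
      rw [hm]
      simp only [Nat.add_sub_cancel]
      have : (m + 1) * (m + 1) = m * (m + 1 + 1) + 1 := by ring
      omega
    have htlt : t < p ^ 2 := by
      have : t * 2 ≤ t * d := Nat.mul_le_mul_left _ hd
      omega
    by_cases hbig : p ^ 2 ≤ R.natDegree
    · apply main
      nlinarith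
    · have hZ0 : Z ≠ 0 := by
        rintro rfl
        rw [zero_pow (by omega), mul_zero, sub_zero] at h1
        have h3 : R.natDegree = p ^ 2 * B.natDegree := by rw [h1, natDegree_pow]
        rcases Nat.eq_zero_or_pos B.natDegree with h | h
        · rw [h] at h3; omega
        · nlinarith
      have e1 : (B ^ p ^ 2).natDegree = p ^ 2 * B.natDegree := natDegree_pow _ _
      have e2 : (X * Z ^ p ^ 2).natDegree = 1 + p ^ 2 * Z.natDegree := by
        rw [natDegree_mul X_ne_zero (pow_ne_zero _ hZ0), natDegree_X, natDegree_pow]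
      have hne : p ^ 2 * B.natDegree ≠ 1 + p ^ 2 * Z.natDegree := by
        intro h
        have : p ^ 2 ∣ 1 := (Nat.dvd_add_left (dvd_mul_right _ _)).mp (h ▸ dvd_mul_right _ _)
        have := Nat.le_of_dvd one_pos this
        omega
      have hle : p ^ 2 * B.natDegree ≤ R.natDegree ∧ 1 + p ^ 2 * Z.natDegree ≤ R.natDegree ∧ 
          (R.natDegree = p ^ 2 * B.natDegree ∨ R.natDegree = 1 + p ^ 2 * Z.natDegree) := by
        rcases lt_or_gt_of_ne hne with h | h
        · have := natDegree_sub_eq_right_of_natDegree_lt (p := B ^ p ^ 2) (q := X * Z ^ p ^ 2)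
            (by rw [e1, e2]; exact h)
          rw [← h1, e2] at this
          omega
        · have := natDegree_sub_eq_left_of_natDegree_lt (p := B ^ p ^ 2) (q := X * Z ^ p ^ 2)
            (by rw [e1, e2]; exact h)
          rw [← h1, e1] at this
          omega
      have hB : B.natDegree = 0 := by
        by_contra h
        have : 1 ≤ B.natDegree := by omega
        nlinarith [hle.1]
      have hZ : Z.natDegree = 0 := by
        by_contra h
        have : 1 ≤ Z.natDegree := by omega
        nlinarith [hle.2.1]
      have hR1 : R.natDegree = 1 := by
        rw [hB, hZ] at hle
        omega
      obtain ⟨b, rfl⟩ : ∃ b, B = C b := ⟨_, eq_C_of_natDegree_eq_zero hB⟩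
      obtain ⟨z, rfl⟩ : ∃ z, Z = C z := ⟨_, eq_C_of_natDegree_eq_zero hZ⟩
      have hz0 : z ≠ 0 := by rintro rfl; simp at hZ0
      obtain ⟨c, hc⟩ : ∃ c : K, c ^ p ^ 2 = b / z := by
        refine ⟨(b / z) ^ p ^ 2, ?_⟩
        rw [← pow_mul, ← hq, ← hcard, FiniteField.pow_card]
      have hQ : C b - X ^ p ^ (4 - 2) * C z = C (-z) * (X - C c) ^ p ^ 2 := by
        rw [sub_pow_char_pow, ← C_pow, hc]
        have : (C b : K[X]) = C z * C (b / z) := by rw [← C_mul]; congr 1; field_simp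
        rw [this, C_neg]
        ring
      rw [hQ, mul_pow, ← pow_mul, ← hq] at h2
      have hdvd : f ∣ (X - C c) ^ p ^ 4 := by
        have h3 : f ∣ C (-z) ^ p ^ 2 * (X - C c) ^ p ^ 4 := by
          rw [← h2]
          exact (dvd_pow_self f (by omega)).mul_right _
        refine (IsUnit.dvd_mul_left ?_).mp h3
        exact (isUnit_C.mpr (isUnit_iff_ne_zero.mpr (neg_ne_zero.mpr hz0))).pow _
      obtain ⟨n, -, hn⟩ := (dvd_prime_pow (prime_X_sub_C c) _).mp hdvd
      obtain ⟨u, hu⟩ := hn.symm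
      obtain ⟨w, hw, hwu⟩ := Polynomial.isUnit_iff.mp u.isUnit
      have hfn : f.natDegree = n := by
        rw [← hu, ← hwu, natDegree_mul_C hw.ne_zero, natDegree_pow, natDegree_X_sub_C, mul_one]
      have hdeg := congrArg natDegree h2
      rw [natDegree_mul (pow_ne_zero _ hf0) hR0, natDegree_pow, hR1, hfn, ← C_pow,
        natDegree_C_mul (pow_ne_zero _ (neg_ne_zero.mpr hz0)), natDegree_pow, natDegree_X_sub_C,
        mul_one, hq] at hdeg
      have hnt : n = (p ^ 2 + 1) * t := by
        apply Nat.eq_of_mul_eq_mul_left (by omega : 0 < d)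
        have : d * ((p ^ 2 + 1) * t) = (t * d) * (p ^ 2 + 1) := by ring
        rw [this, htd]
        obtain ⟨m, hm⟩ : ∃ m, p ^ 2 = m + 1 := ⟨p ^ 2 - 1, by omega⟩
        rw [hm] at hdeg ⊢
        simp only [Nat.add_sub_cancel]
        have : (m + 1) * (m + 1) = m * (m + 1 + 1) + 1 := by ring
        omega
      refine ⟨w, (X - C c) ^ (p ^ 2 + 1), ?_⟩
      rw [← hu, ← hwu, hnt, pow_mul, mul_comm]
  · apply main
    rw [hcard, ← htd] at hDd
    have := Nat.le_of_mul_le_mul_right hDd (by omega)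
    nlinarith

lemma aux_24 {K : Type*} [Field K] [Fintype K] [DecidableEq K] (p : ℕ) [Fact p.Prime] [CharP K p]
    (hcard : Fintype.card K = p ^ 4) (f : K[X]) (d t e : ℕ) (hd : 2 ≤ d)
    (hD : 0 < f.natDegree) (hDd : f.natDegree * d ≤ Fintype.card K - 1) 
    (hf : ∀ a, f.eval a ^ (d + 1) = f.eval a) (hz : ∃ a, f.eval a = 0)
    (he : e = 2 ∨ e = 4) (htd : t * d = p ^ e - 1)
    (hmin : ∀ s, 0 < s → s < e → ¬ d ∣ p ^ s - 1) :
    ∃ (c : K) (g : K[X]), f = C c * g ^ t := by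
  have hf0 : f ≠ 0 := by rintro rfl; simp at hD
  have key : ∀ s, 1 ≤ s → s ≤ e → ∃ B Z : K[X], 
      (∏ a ∈ Finset.univ.filter (fun a => f.eval a = 0), (X - C a)) = B ^ p ^ s - X * Z ^ p ^ s ∧
      f ^ d * (∏ a ∈ Finset.univ.filter (fun a => f.eval a = 0), (X - C a))
        = (B - X ^ p ^ (4 - s) * Z) ^ p ^ s := by
    intro s hs
    induction s, hs using Nat.le_induction with
    | base => intro _; exact aux_start p hcard f d hd hD hDd hf hz _ rfl
    | succ s hs ih =>
      intro hse
      obtain ⟨B, Z, h1, h2⟩ := ih (by omega)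
      exact aux_step p f d hf0 hz _ rfl s hs (by omega) (hmin s (by omega) (by omega)) B Z h1 h2
  obtain ⟨B, Z, h1, h2⟩ := key e (by omega) le_rfl
  exact aux_fin p hcard f d t e hd hD hDd hz _ rfl he htd B Z h1 h2

lemma aux_digit {p a b a' b' : ℕ} (ha : a < p) (ha' : a' < p) (h : a + p * b = a' + p * b') :
    a = a' ∧ b = b' := by
  have h1 := congrArg (· % p) h
  simp only [Nat.add_mul_mod_self_left, Nat.mod_eq_of_lt ha, Nat.mod_eq_of_lt ha'] at h1
  subst h1
  exact ⟨rfl, Nat.eq_of_mul_eq_mul_left (by omega) (Nat.add_left_cancel h)⟩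

lemma aux_degreeOf_pderiv {K : Type*} [Field K] (i j : Fin 4) (Φ : MvPolynomial (Fin 4) K) :
    (MvPolynomial.pderiv j Φ).degreeOf i ≤ Φ.degreeOf i := by
  rw [MvPolynomial.degreeOf_le_iff]
  intro m hm
  rw [MvPolynomial.mem_support_iff, MvPolynomial.coeff_pderiv] at hm
  have h1 := left_ne_zero_of_mul hm
  have := MvPolynomial.monomial_le_degreeOf i (MvPolynomial.mem_support_iff.mpr h1)
  rw [Finsupp.add_apply] at this
  omega

lemma aux_degreeOf_pderiv_lt {K : Type*} [Field K] (j : Fin 4) (Φ : MvPolynomial (Fin 4) K)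
    (h : 0 < Φ.degreeOf j) :
    (MvPolynomial.pderiv j Φ).degreeOf j < Φ.degreeOf j := by
  rw [MvPolynomial.degreeOf_lt_iff h]
  intro m hm
  rw [MvPolynomial.mem_support_iff, MvPolynomial.coeff_pderiv] at hm
  have h1 := left_ne_zero_of_mul hm
  have := MvPolynomial.monomial_le_degreeOf j (MvPolynomial.mem_support_iff.mpr h1)
  rw [Finsupp.add_apply, Finsupp.single_eq_same] at this
  omega

lemma aux_pderiv_ne {K : Type*} [Field K] (p : ℕ) [CharP K p] (j : Fin 4)
    (Φ : MvPolynomial (Fin 4) K)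
    (h : 0 < Φ.degreeOf j) (hp : Φ.degreeOf j < p) : MvPolynomial.pderiv j Φ ≠ 0 := by
  intro h0
  have : Φ.degreeOf j ≤ 0 := by
    rw [MvPolynomial.degreeOf_le_iff]
    intro m hm
    by_contra hne
    have h1 := MvPolynomial.coeff_pderiv (i := j) Φ (m - Finsupp.single j 1)
    have h2 : m - Finsupp.single j 1 + Finsupp.single j 1 = m :=
      Finsupp.sub_add_single_one_cancel (by omega)
    have h4 := MvPolynomial.monomial_le_degreeOf j hm
    rw [h0, h2, MvPolynomial.coeff_zero] at h1
    rcases mul_eq_zero.mp h1.symm with h3 | h3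
    · exact MvPolynomial.mem_support_iff.mp hm h3
    · rw [Finsupp.tsub_apply, Finsupp.single_eq_same] at h3
      have h5 : ((m j : ℕ) : K) = 0 := by
        rw [← h3]
        obtain ⟨n, hn⟩ : ∃ n, m j = n + 1 := ⟨m j - 1, by omega⟩
        rw [hn]; simp
      rw [CharP.cast_eq_zero_iff K p] at h5
      have := Nat.le_of_dvd (by omega) h5
      omega
  omega

lemma aux_aeval {K : Type*} [Field K] (p : ℕ) (Ψ : MvPolynomial (Fin 4) K) :
    MvPolynomial.aeval (fun i : Fin 4 => (X : K[X]) ^ p ^ (i : ℕ)) Ψ =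
      ∑ m ∈ Ψ.support, monomial (m 0 + p * (m 1 + p * (m 2 + p * m 3))) (Ψ.coeff m) := by
  rw [MvPolynomial.aeval_def, MvPolynomial.eval₂_eq']
  refine Finset.sum_congr rfl fun m _ => ?_
  rw [← C_mul_X_pow_eq_monomial, Fin.prod_univ_four]
  simp only [algebraMap_eq, ← pow_mul, ← pow_add]
  congr 2
  simp
  ring

lemma aux_eval {K : Type*} [Field K] (p : ℕ) (Ψ : MvPolynomial (Fin 4) K) (a : K) :
    (MvPolynomial.aeval (fun i : Fin 4 => (X : K[X]) ^ p ^ (i : ℕ)) Ψ).eval a =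
      MvPolynomial.eval (fun i : Fin 4 => a ^ p ^ (i : ℕ)) Ψ := by
  induction Ψ using MvPolynomial.induction_on with
  | C a => simp
  | add f g hf hg => simp [hf, hg]
  | mul_X f i hf => simp [hf]

lemma aux_inj {K : Type*} [Field K] [Fintype K] (p : ℕ) (hcard : Fintype.card K = p ^ 4)
    (hp : p.Prime) (Ψ : MvPolynomial (Fin 4) K)
    (hdeg : ∀ i, Ψ.degreeOf i < p)
    (h : ∀ a : K, MvPolynomial.eval (fun i : Fin 4 => a ^ p ^ (i : ℕ)) Ψ = 0) : Ψ = 0 := by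
  have hm : ∀ m ∈ Ψ.support, ∀ i, m i < p := fun m hm i =>
    lt_of_le_of_lt (MvPolynomial.monomial_le_degreeOf i hm) (hdeg i)
  have hu : MvPolynomial.aeval (fun i : Fin 4 => (X : K[X]) ^ p ^ (i : ℕ)) Ψ = 0 := by
    by_contra hne
    have h1 := aux_card_le Finset.univ _ hne (fun a _ => by rw [aux_eval]; exact h a)
    rw [Finset.card_univ, hcard] at h1
    have h2 : (MvPolynomial.aeval (fun i : Fin 4 => (X : K[X]) ^ p ^ (i : ℕ)) Ψ).natDegree
        ≤ p ^ 4 - 1 := by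
      rw [aux_aeval]
      apply natDegree_sum_le_of_forall_le
      intro m hmm
      refine (natDegree_monomial_le _).trans ?_
      have e0 := hm m hmm 0
      have e1 := hm m hmm 1
      have e2 := hm m hmm 2
      have e3 := hm m hmm 3
      apply Nat.le_sub_one_of_lt
      have f3 : m 2 + p * m 3 < p ^ 2 := by nlinarith
      have f2 : m 1 + p * (m 2 + p * m 3) < p ^ 3 := by nlinarith
      nlinarith
    have : 0 < p ^ 4 := pow_pos hp.pos _
    omega
  by_contra hne
  obtain ⟨m, hmm⟩ := MvPolynomial.support_nonempty.mpr hne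
  rw [aux_aeval] at hu
  have h1 := congrArg (fun g => g.coeff (m 0 + p * (m 1 + p * (m 2 + p * m 3)))) hu
  simp only [finsetSum_coeff, coeff_monomial, coeff_zero] at h1
  rw [Finset.sum_eq_single m] at h1
  · rw [if_pos rfl] at h1
    exact MvPolynomial.mem_support_iff.mp hmm h1
  · intro n hn hnm
    apply if_neg
    intro heq
    apply hnm
    obtain ⟨g0, heq⟩ := aux_digit (hm n hn 0) (hm m hmm 0) heq
    obtain ⟨g1, heq⟩ := aux_digit (hm n hn 1) (hm m hmm 1) heq
    obtain ⟨g2, g3⟩ := aux_digit (hm n hn 2) (hm m hmm 2) heq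
    have g3 : n 3 = m 3 := Nat.eq_of_mul_eq_mul_left hp.pos (by omega)
    ext i
    fin_cases i
    · exact g0
    · exact g1
    · exact g2
    · exact g3
  · intro h; exact absurd hmm h

lemma aux_exists {K : Type*} [Field K] (p : ℕ) (hp : p.Prime) (f : K[X]) (t : ℕ) (ht : t < p)
    (hD : f.natDegree ≤ t * (1 + p + p ^ 2 + p ^ 3)) :
    ∃ Φ : MvPolynomial (Fin 4) K, (∀ i, Φ.degreeOf i < p) ∧ Φ.degreeOf 3 ≤ t ∧
      MvPolynomial.aeval (fun i : Fin 4 => (X : K[X]) ^ p ^ (i : ℕ)) Φ = f := by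
  have hpp := hp.pos
  refine ⟨∑ k ∈ f.support, MvPolynomial.monomial
    (Finsupp.equivFunOnFinite.symm (fun i : Fin 4 => k / p ^ (i : ℕ) % p)) (f.coeff k), ?_, ?_, ?_⟩
  · intro i
    refine lt_of_le_of_lt (MvPolynomial.degreeOf_sum_le _ _ _) ?_
    rw [Finset.sup_lt_iff hpp]
    intro k hk
    rw [MvPolynomial.degreeOf_monomial_eq _ _ (mem_support_iff.mp hk)]
    exact Nat.mod_lt _ hpp
  · refine (MvPolynomial.degreeOf_sum_le _ _ _).trans ?_
    apply Finset.sup_le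
    intro k hk
    rw [MvPolynomial.degreeOf_monomial_eq _ _ (mem_support_iff.mp hk)]
    refine (Nat.mod_le _ _).trans ?_
    have h1 : k ≤ f.natDegree := le_natDegree_of_mem_supp k hk
    have h2 : k < p ^ 3 * (t + 1) := by
      have : t * (1 + p + p ^ 2) < p ^ 3 := by
        have : t * (1 + p + p ^ 2) ≤ (p - 1) * (1 + p + p ^ 2) := Nat.mul_le_mul_right _ (by omega)
        obtain ⟨r, rfl⟩ : ∃ r, p = r + 1 := ⟨p - 1, by omega⟩
        simp only [Nat.add_sub_cancel] at this
        nlinarith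
      nlinarith
    have := Nat.div_lt_of_lt_mul h2
    simpa using Nat.lt_succ_iff.mp this
  · rw [map_sum]
    conv_rhs => rw [f.as_sum_support]
    refine Finset.sum_congr rfl fun k hk => ?_
    rw [MvPolynomial.aeval_monomial, Finsupp.prod_fintype _ _ (fun i => pow_zero _),
      Fin.prod_univ_four, ← C_mul_X_pow_eq_monomial]
    simp only [algebraMap_eq, ← pow_mul, ← pow_add]
    congr 2
    simp
    have h1 : k ≤ f.natDegree := le_natDegree_of_mem_supp k hk
    have h2 : k < p ^ 3 * p := by
      have : t * (1 + p + p ^ 2 + p ^ 3) ≤ (p - 1) * (1 + p + p ^ 2 + p ^ 3) :=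
        Nat.mul_le_mul_right _ (by omega)
      obtain ⟨r, rfl⟩ : ∃ r, p = r + 1 := ⟨p - 1, by omega⟩
      simp only [Nat.add_sub_cancel] at this
      nlinarith
    have h3 := Nat.mod_eq_of_lt (Nat.div_lt_of_lt_mul h2)
    rw [h3]
    have a0 := Nat.mod_add_div k p
    have a1 := Nat.mod_add_div (k / p) p
    have a2 := Nat.mod_add_div (k / p / p) p
    rw [Nat.div_div_eq_div_mul, ← sq] at a1 a2
    rw [Nat.div_div_eq_div_mul, ← pow_succ] at a2
    norm_num at a2
    conv_rhs => rw [← a0, ← a1, ← a2]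
    ring

lemma aux_chain {K : Type*} [Field K] (p : ℕ) [CharP K p] (Ψ : MvPolynomial (Fin 4) K) :
    derivative (MvPolynomial.aeval (fun i : Fin 4 => (X : K[X]) ^ p ^ (i : ℕ)) Ψ) =
      MvPolynomial.aeval (fun i : Fin 4 => (X : K[X]) ^ p ^ (i : ℕ)) (MvPolynomial.pderiv 0 Ψ) := by
  induction Ψ using MvPolynomial.induction_on with
  | C a => simp
  | add f g hf hg => simp [hf, hg]
  | mul_X f i hf =>
    rw [map_mul, derivative_mul, hf, MvPolynomial.pderiv_mul, map_add, map_mul, map_mul,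
      MvPolynomial.aeval_X]
    congr 2
    rw [derivative_X_pow]
    by_cases hi : i = 0
    · subst hi; simp
    · have : (i : ℕ) ≠ 0 := fun h => hi (Fin.ext h)
      rw [MvPolynomial.pderiv_X_of_ne hi, Nat.cast_pow, CharP.cast_eq_zero, zero_pow this]
      simp

lemma aux_mult {A : Type*} [CommRing A] [IsDomain A] (δ : A → A)
    (hmul : ∀ x y, δ (x * y) = δ x * y + x * δ y)
    (hpow : ∀ x (n : ℕ), x * δ (x ^ n) = n * x ^ n * δ x)
    (Φ π ψ : A) (m t : ℕ) (hΦ : Φ = π ^ m * ψ) (hπ : Prime π) (hψ : ¬ π ∣ ψ)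
    (hδ : ¬ π ∣ δ π) (h : t * (Φ * δ (δ Φ)) = (t - 1) * (δ Φ) ^ 2) :
    π ∣ (m : A) * (m - t) := by
  set B := m * (δ π * ψ) + π * δ ψ with hB
  have hπ0 := hπ.ne_zero
  have h1 : π * δ Φ = π ^ m * B := by
    rw [hΦ, hmul, hB]
    linear_combination ψ * hpow π m
  have h2 : π ^ 2 * δ (δ Φ) = π ^ m * ((m - 1) * (δ π * B) + π * δ B) := by
    have h3 := congrArg δ h1
    rw [hmul, hmul] at h3
    linear_combination π * h3 + B * hpow π m - δ π * h1
  have h4 : t * ψ * ((m - 1) * (δ π * B) + π * δ B) = (t - 1) * B ^ 2 := by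
    apply mul_left_cancel₀ (pow_ne_zero 2 (pow_ne_zero m hπ0))
    have e1 : (π ^ m * B) ^ 2 = (π * δ Φ) ^ 2 := by rw [h1]
    calc _ = t * (π ^ m * ψ) * (π ^ m * ((m - 1) * (δ π * B) + π * δ B)) := by ring
      _ = t * Φ * (π ^ 2 * δ (δ Φ)) := by rw [← hΦ, ← h2]
      _ = π ^ 2 * ((t - 1) * (δ Φ) ^ 2) := by rw [← h]; ring
      _ = (t - 1) * (π * δ Φ) ^ 2 := by ring
      _ = _ := by rw [← e1]; ring
  have h5 : π ∣ ((m : A) * (m - t)) * ((δ π) ^ 2 * ψ ^ 2) := by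
    refine ⟨?_, ?_⟩
    rotate_left
    · rw [hB] at h4
      have : ((m : A) * (m - t)) * ((δ π) ^ 2 * ψ ^ 2) = 
        π * ((t - 1) * (2 * m * δ π * ψ * δ ψ + π * (δ ψ) ^ 2) - t * ψ * ((m - 1) * (δ π * δ ψ) + δ B)) := by
        rw [hB]
        linear_combination h4
      exact this
  rcases hπ.dvd_or_dvd h5 with h6 | h6
  · exact h6
  · exfalso
    rcases hπ.dvd_or_dvd h6 with h7 | h7
    · exact hδ (hπ.dvd_of_dvd_pow h7)
    · exact hψ (hπ.dvd_of_dvd_pow h7)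

lemma aux_second {K : Type*} [Field K] [Fintype K] [DecidableEq K] (f : K[X]) (d t : ℕ)
    (hd : 2 ≤ d) (hD : 0 < f.natDegree) (hDd : f.natDegree * d ≤ Fintype.card K - 1)
    (hf : ∀ a, f.eval a ^ (d + 1) = f.eval a) (htd : (t : K) * (d : K) = -1) :
    (t : K[X]) * (f * derivative (derivative f)) = ((t : K[X]) - 1) * (derivative f) ^ 2 := by
  have h := aux_ode f d hd hD hDd hf
  have hP := aux_derivP (K := K)
  have hP0 := FiniteField.X_pow_card_sub_X_ne_zero K (Fintype.one_lt_card (α := K))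
  set P : K[X] := X ^ Fintype.card K - X with hPdef
  have hC : (C (d : K) : K[X]) = (d : K[X]) := by simp
  rw [hC] at h
  have htd' : (t : K[X]) * (d : K[X]) = -1 := by
    have := congrArg (fun x => (C x : K[X])) htd
    simpa using this
  have h1 := congrArg derivative h
  simp only [derivative_sub, derivative_neg, derivative_mul, derivative_natCast, derivative_pow,
    hP, zero_mul, zero_add, Nat.add_sub_cancel] at h1
  have hC2 : (C ((d + 1 : ℕ) : K) : K[X]) = (d : K[X]) + 1 := by simp
  rw [hC2] at h1
  apply mul_left_cancel₀ hP0
  clear_value P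
  linear_combination (-(t : K[X]) ^ 2) * (f * h1 - ((d : K[X]) + 1) * derivative f * h) +
    (P * t * (f * derivative (derivative f) - ((d : K[X]) + 1) * derivative f ^ 2) +
      P * derivative f ^ 2) * htd'

lemma aux_tau_deg {K : Type*} [Field K] (φ : K →+* K) (Φ : MvPolynomial (Fin 4) K) (i : Fin 4) :
    (MvPolynomial.rename (fun i : Fin 4 => i + 1) (MvPolynomial.map φ Φ)).degreeOf (i + 1) =
      Φ.degreeOf i := by
  rw [MvPolynomial.degreeOf_rename_of_injective (f := fun i : Fin 4 => i + 1)
    (add_left_injective 1) i]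
  rw [MvPolynomial.degreeOf_eq_sup, MvPolynomial.degreeOf_eq_sup,
    MvPolynomial.support_map_of_injective _ φ.injective]

lemma aux_tau_pd {K : Type*} [Field K] (φ : K →+* K) (Φ : MvPolynomial (Fin 4) K) (i : Fin 4) :
    MvPolynomial.pderiv (i + 1) (MvPolynomial.rename (fun i : Fin 4 => i + 1)
      (MvPolynomial.map φ Φ)) =
    MvPolynomial.rename (fun i : Fin 4 => i + 1) (MvPolynomial.map φ (MvPolynomial.pderiv i Φ)) := by
  rw [MvPolynomial.pderiv_rename (f := fun i : Fin 4 => i + 1) (add_left_injective 1) i,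
    MvPolynomial.pderiv_map]

lemma aux_tau_eval {K : Type*} [Field K] [Fintype K] (p : ℕ) [Fact p.Prime] [CharP K p]
    (hcard : Fintype.card K = p ^ 4) (Φ : MvPolynomial (Fin 4) K) (a : K) :
    MvPolynomial.eval (fun i : Fin 4 => a ^ p ^ (i : ℕ))
      (MvPolynomial.rename (fun i : Fin 4 => i + 1) (MvPolynomial.map (frobenius K p) Φ)) =
      (MvPolynomial.eval (fun i : Fin 4 => a ^ p ^ (i : ℕ)) Φ) ^ p := by
  have ha : a ^ p ^ 4 = a := by rw [← hcard]; exact FiniteField.pow_card a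
  have hv : ∀ i : Fin 4, a ^ p ^ ((i + 1 : Fin 4) : ℕ) = (a ^ p ^ (i : ℕ)) ^ p := by
    intro i
    rw [← pow_mul, ← pow_succ]
    fin_cases i
    · rfl
    · rfl
    · rfl
    · simp [ha]
  induction Φ using MvPolynomial.induction_on with
  | C a => simp [frobenius_def]
  | add f g hf hg => rw [map_add, map_add, map_add, map_add, hf, hg, add_pow_char]
  | mul_X f i hf =>
    rw [map_mul, map_mul, map_mul, map_mul, hf, mul_pow, MvPolynomial.map_X,
      MvPolynomial.rename_X, MvPolynomial.eval_X, MvPolynomial.eval_X, hv]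

lemma aux_const {K : Type*} [Field K] (π : MvPolynomial (Fin 4) K)
    (h : ∀ j, π.degreeOf j = 0) : ∃ c, π = MvPolynomial.C c := by
  refine ⟨π.coeff 0, ?_⟩
  ext m
  rw [MvPolynomial.coeff_C]
  split_ifs with hm
  · rw [hm]
  · by_contra hne
    apply hm
    ext j
    have := MvPolynomial.monomial_le_degreeOf j (MvPolynomial.mem_support_iff.mpr hne)
    rw [h j] at this
    simp; omega

lemma aux_fin4 (P : Fin 4 → Prop) (h0 : P 0) (hs : ∀ j, P j → P (j + 1)) : ∀ j, P j := by
  have h1 : P 1 := hs 0 h0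
  have h2 : P 2 := hs 1 h1
  have h3 : P 3 := hs 2 h2
  intro j
  fin_cases j
  · exact h0
  · exact h1
  · exact h2
  · exact h3

lemma aux_fac {K : Type*} [Field K] (p : ℕ) [CharP K p] (t : ℕ) (h2t : 2 * t < p)
    (Φ : MvPolynomial (Fin 4) K) (hdt : ∀ i, Φ.degreeOf i ≤ t)
    (hid : ∀ j : Fin 4, (t : MvPolynomial (Fin 4) K) *
      (Φ * MvPolynomial.pderiv j (MvPolynomial.pderiv j Φ)) =
      ((t : MvPolynomial (Fin 4) K) - 1) * (MvPolynomial.pderiv j Φ) ^ 2)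
    (π : MvPolynomial (Fin 4) K) (hπ : Prime π) (m : ℕ) (ψ : MvPolynomial (Fin 4) K)
    (hm : 0 < m) (hΦe : Φ = π ^ m * ψ) (hψ : ¬ π ∣ ψ) : m = t := by
  have hπ0 := hπ.ne_zero
  have hψ0 : ψ ≠ 0 := by rintro rfl; exact hψ (dvd_zero _)
  have hdg : ∀ j, m * π.degreeOf j ≤ t := by
    intro j
    have := hdt j
    rw [hΦe, MvPolynomial.degreeOf_mul_eq (pow_ne_zero _ hπ0) hψ0,
      MvPolynomial.degreeOf_pow_eq _ _ _ hπ0] at this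
    omega
  obtain ⟨j, hj⟩ : ∃ j, 0 < π.degreeOf j := by
    by_contra hno
    push Not at hno
    obtain ⟨c, hc⟩ := aux_const π (fun j => Nat.le_zero.mp (hno j))
    apply hπ.not_isUnit
    rw [hc]
    apply IsUnit.map
    rw [isUnit_iff_ne_zero]
    rintro rfl
    exact hπ0 (by rw [hc, map_zero])
  have hmt : m ≤ t := le_trans (Nat.le_mul_of_pos_right m hj) (hdg j)
  have hjt : π.degreeOf j ≤ t := le_trans (Nat.le_mul_of_pos_left _ hm) (hdg j)
  have hne := aux_pderiv_ne p j π hj (by omega)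
  have hnd : ¬ π ∣ MvPolynomial.pderiv j π := by
    rintro ⟨w, hw⟩
    have hw0 : w ≠ 0 := by
      rintro rfl
      exact hne (by rw [hw, mul_zero])
    have h1 := aux_degreeOf_pderiv_lt j π hj
    rw [hw, MvPolynomial.degreeOf_mul_eq hπ0 hw0] at h1
    omega
  have hdv : π ∣ (m : MvPolynomial (Fin 4) K) * (m - t) := by
    have hpw : ∀ (x : MvPolynomial (Fin 4) K) (n : ℕ), x * MvPolynomial.pderiv j (x ^ n) =
        n * x ^ n * MvPolynomial.pderiv j x := by
      intro x n
      rw [MvPolynomial.pderiv_pow]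
      rcases n with _ | n
      · simp
      · rw [Nat.add_sub_cancel]; ring
    have hml : ∀ x y : MvPolynomial (Fin 4) K, MvPolynomial.pderiv j (x * y) =
        MvPolynomial.pderiv j x * y + x * MvPolynomial.pderiv j y := by
      intro x y
      rw [MvPolynomial.pderiv_mul]
    exact aux_mult (fun x => MvPolynomial.pderiv j x) hml hpw Φ π ψ m t hΦe hπ hψ hnd (hid j)
  have hz : (m : K) * ((m : K) - t) = 0 := by
    by_contra hnz
    apply hπ.not_isUnit
    refine isUnit_of_dvd_unit hdv ?_
    have : (m : MvPolynomial (Fin 4) K) * ((m : MvPolynomial (Fin 4) K) - (t : MvPolynomial (Fin 4) K)) =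
      MvPolynomial.C ((m : K) * ((m : K) - t)) := by simp
    rw [this]
    exact IsUnit.map _ (isUnit_iff_ne_zero.mpr hnz)
  rcases mul_eq_zero.mp hz with h1 | h1
  · rw [CharP.cast_eq_zero_iff K p] at h1
    have := Nat.le_of_dvd hm h1
    omega
  · have h2 : ((t - m : ℕ) : K) = 0 := by
      rw [Nat.cast_sub hmt]
      linear_combination -h1
    rw [CharP.cast_eq_zero_iff K p] at h2
    by_contra hmt'
    have := Nat.le_of_dvd (by omega) h2
    omega

lemma aux_1 {K : Type*} [Field K] [Fintype K] [DecidableEq K] (p : ℕ) [Fact p.Prime] [CharP K p]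
    (hcard : Fintype.card K = p ^ 4) (f : K[X]) (d t : ℕ) (hd : 2 ≤ d)
    (hD : 0 < f.natDegree) (hDd : f.natDegree * d ≤ Fintype.card K - 1)
    (hf : ∀ a, f.eval a ^ (d + 1) = f.eval a) (htd : t * d = p - 1) :
    ∃ c g, f = C c * g ^ t := by
  have hp : p.Prime := Fact.out
  have hp2 := hp.two_le
  have ht0 : 0 < t := by
    rcases Nat.eq_zero_or_pos t with h | h
    · subst h; omega
    · exact h
  have h2t : 2 * t < p := by nlinarith [Nat.mul_le_mul_left t hd, Nat.sub_add_cancel hp.one_le]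
  have htK : (t : K) * (d : K) = -1 := by
    rw [← Nat.cast_mul, htd, Nat.cast_sub hp.one_le]
    simp
  have hsec := aux_second f d t hd hD hDd hf htK
  have hfp : ∀ a, f.eval a ^ p = f.eval a := by
    intro a
    by_cases h0 : f.eval a = 0
    · rw [h0, zero_pow hp.ne_zero]
    · have h2 : f.eval a ^ d = 1 := by
        have := hf a
        rw [pow_succ] at this
        exact mul_right_cancel₀ h0 (by rw [this, one_mul])
      have : p = d * t + 1 := by rw [mul_comm, htd]; omega
      conv_lhs => rw [this, pow_succ, pow_mul, h2, one_pow, one_mul]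
  have hdeg : f.natDegree ≤ t * (1 + p + p ^ 2 + p ^ 3) := by
    apply Nat.le_of_mul_le_mul_right (c := d) _ (by omega)
    refine hDd.trans (le_of_eq ?_)
    rw [hcard]
    obtain ⟨r, rfl⟩ : ∃ r, p = r + 1 := ⟨p - 1, by omega⟩
    rw [mul_right_comm, htd, Nat.add_sub_cancel]
    apply Nat.sub_eq_of_eq_add
    ring
  obtain ⟨Φ, hΦp, hΦ3, hΦf⟩ := aux_exists p hp f t (by omega) hdeg
  have hev : ∀ a, MvPolynomial.eval (fun i : Fin 4 => a ^ p ^ (i : ℕ)) Φ = f.eval a := by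
    intro a; rw [← aux_eval, hΦf]
  set τ : MvPolynomial (Fin 4) K →+* MvPolynomial (Fin 4) K :=
    ((MvPolynomial.rename (R := K) (fun i : Fin 4 => i + 1)).toRingHom).comp
      (MvPolynomial.map (frobenius K p)) with hτ
  have hτa : ∀ Ψ, τ Ψ = MvPolynomial.rename (fun i : Fin 4 => i + 1)
      (MvPolynomial.map (frobenius K p) Ψ) := fun Ψ => rfl
  have hτΦ : τ Φ = Φ := by
    rw [← sub_eq_zero]
    apply aux_inj p hcard hp
    · intro i
      refine lt_of_le_of_lt (MvPolynomial.degreeOf_sub_le _ _ _) (max_lt ?_ (hΦp i))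
      have := aux_tau_deg (frobenius K p) Φ (i - 1)
      rw [sub_add_cancel] at this
      rw [hτa, this]
      exact hΦp _
    · intro a
      rw [map_sub, hτa, aux_tau_eval p hcard, hev, hfp, sub_self]
  have hstep : ∀ i, Φ.degreeOf (i + 1) = Φ.degreeOf i := by
    intro i
    have := aux_tau_deg (frobenius K p) Φ i
    rwa [← hτa, hτΦ] at this
  have hdt : ∀ i, Φ.degreeOf i ≤ t := by
    have h30 : Φ.degreeOf 0 ≤ t := by
      have := hstep 3
      rw [show (3 : Fin 4) + 1 = 0 from rfl] at this
      rw [this]; exact hΦ3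
    exact aux_fin4 (fun i => Φ.degreeOf i ≤ t) h30 (fun j hj => by rw [hstep]; exact hj)
  have hid0 : (t : MvPolynomial (Fin 4) K) *
      (Φ * MvPolynomial.pderiv 0 (MvPolynomial.pderiv 0 Φ)) =
      ((t : MvPolynomial (Fin 4) K) - 1) * (MvPolynomial.pderiv 0 Φ) ^ 2 := by
    rw [← sub_eq_zero]
    have hd1 : ∀ i, (MvPolynomial.pderiv 0 Φ).degreeOf i ≤ t := fun i =>
      (aux_degreeOf_pderiv i 0 _).trans (hdt i)
    have hd2 : ∀ i, (MvPolynomial.pderiv 0 (MvPolynomial.pderiv 0 Φ)).degreeOf i ≤ t := fun i =>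
      (aux_degreeOf_pderiv i 0 _).trans (hd1 i)
    have ec : (t : MvPolynomial (Fin 4) K) = MvPolynomial.C (t : K) := by simp
    have ec1 : (t : MvPolynomial (Fin 4) K) - 1 = MvPolynomial.C ((t : K) - 1) := by simp
    apply aux_inj p hcard hp
    · intro i
      refine lt_of_le_of_lt (MvPolynomial.degreeOf_sub_le _ _ _) (max_lt ?_ ?_)
      · rw [ec]
        refine lt_of_le_of_lt (MvPolynomial.degreeOf_C_mul_le _ _ _) ?_
        refine lt_of_le_of_lt (MvPolynomial.degreeOf_mul_le _ _ _) ?_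
        have := hdt i
        have := hd2 i
        omega
      · rw [ec1]
        refine lt_of_le_of_lt (MvPolynomial.degreeOf_C_mul_le _ _ _) ?_
        refine lt_of_le_of_lt (MvPolynomial.degreeOf_pow_le _ _ _) ?_
        have := hd1 i
        omega
    · intro a
      rw [← aux_eval]
      simp only [map_sub, map_mul, map_pow, map_natCast, map_one, ← aux_chain, hΦf]
      rw [hsec, sub_self, eval_zero]
  have hid : ∀ j : Fin 4, (t : MvPolynomial (Fin 4) K) *
      (Φ * MvPolynomial.pderiv j (MvPolynomial.pderiv j Φ)) =
      ((t : MvPolynomial (Fin 4) K) - 1) * (MvPolynomial.pderiv j Φ) ^ 2 := by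
    have hs : ∀ j : Fin 4, (t : MvPolynomial (Fin 4) K) *
      (Φ * MvPolynomial.pderiv j (MvPolynomial.pderiv j Φ)) =
      ((t : MvPolynomial (Fin 4) K) - 1) * (MvPolynomial.pderiv j Φ) ^ 2 →
      (t : MvPolynomial (Fin 4) K) *
      (Φ * MvPolynomial.pderiv (j + 1) (MvPolynomial.pderiv (j + 1) Φ)) =
      ((t : MvPolynomial (Fin 4) K) - 1) * (MvPolynomial.pderiv (j + 1) Φ) ^ 2 := by
      intro j hj
      have h1 := congrArg τ hj
      have hpd : ∀ Ψ, τ (MvPolynomial.pderiv j Ψ) = MvPolynomial.pderiv (j + 1) (τ Ψ) :=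
        fun Ψ => (aux_tau_pd (frobenius K p) Ψ j).symm
      simpa only [map_sub, map_mul, map_pow, map_natCast, map_one, hpd, hτΦ] using h1
    exact aux_fin4 (fun j : Fin 4 => (t : MvPolynomial (Fin 4) K) *
      (Φ * MvPolynomial.pderiv j (MvPolynomial.pderiv j Φ)) =
      ((t : MvPolynomial (Fin 4) K) - 1) * (MvPolynomial.pderiv j Φ) ^ 2) hid0 hs
  have hΦ0 : Φ ≠ 0 := by
    rintro rfl
    rw [map_zero] at hΦf
    rw [← hΦf] at hD
    simp at hD
  obtain ⟨u, b, hu, hub⟩ := aux_uniq t Φ hΦ0 (fun π hπ m ψ hm hΦe hψ =>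
    aux_fac p t h2t Φ hdt hid π hπ m ψ hm hΦe hψ)
  obtain ⟨c, -, hc⟩ := MvPolynomial.isUnit_iff_eq_C_of_isReduced.mp hu
  refine ⟨c, MvPolynomial.aeval (fun i : Fin 4 => (X : K[X]) ^ p ^ (i : ℕ)) b, ?_⟩
  rw [← hΦf, hub, hc, map_mul, map_pow]
  simp

lemma aux_div4 (e : ℕ) (he : e ∣ 4) : e = 1 ∨ e = 2 ∨ e = 4 := by
  have h4 := Nat.le_of_dvd (by norm_num) he
  interval_cases e <;> omega

lemma aux_cyc {K : Type*} [Field K] [Fintype K] [DecidableEq K] (a b : ℕ) (hb : 0 < b) (ha : 0 < a)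
    (h : a * b ∣ Fintype.card K - 1) (s : K) (hs : s ^ a = 1) :
    ∃ u : K, u ^ (a * b) = 1 ∧ u ^ b = s := by
  obtain ⟨g, hg⟩ := IsCyclic.exists_generator (α := Kˣ)
  have hord : orderOf g = Fintype.card K - 1 := by
    rw [orderOf_eq_card_of_forall_mem_zpowers hg, Nat.card_eq_fintype_card, Fintype.card_units]
  have hs0 : s ≠ 0 := by rintro rfl; rw [zero_pow ha.ne'] at hs; exact zero_ne_one hs
  obtain ⟨i, hi⟩ := (mem_powers_iff_mem_zpowers (x := g)).mpr (hg (Units.mk0 s hs0))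
  simp only at hi
  obtain ⟨c, hc⟩ := h
  have h1 : g ^ (i * a) = 1 := by
    rw [pow_mul, hi]; ext; simpa using hs
  have h2 := orderOf_dvd_of_pow_eq_one h1
  rw [hord, hc] at h2
  have h3 : b * c ∣ i := by
    apply Nat.dvd_of_mul_dvd_mul_left ha
    rw [← mul_assoc, mul_comm a i]; exact h2
  obtain ⟨j, rfl⟩ := h3
  have hgs : ((g : K)) ^ (b * c * j) = s := by
    have := congrArg (fun x : Kˣ => (x : K)) hi
    simpa using this
  refine ⟨(g : K) ^ (c * j), ?_, ?_⟩
  · have h4 : g ^ (Fintype.card K - 1) = 1 := by rw [← hord]; exact pow_orderOf_eq_one g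
    rw [hc] at h4
    have h5 := congrArg (fun x : Kˣ => (x : K)) h4
    simp only [Units.val_pow_eq_pow_val, Units.val_one] at h5
    rw [← pow_mul, show c * j * (a * b) = a * b * c * j by ring, pow_mul, h5, one_pow]
  · rw [← pow_mul, ← hgs]; congr 1; ring

lemma aux_prim {K : Type*} [Field K] [Fintype K] [DecidableEq K] (d : ℕ) (h : d ∣ Fintype.card K - 1) :
    ∃ z : K, IsPrimitiveRoot z d := by
  obtain ⟨g, hg⟩ := IsCyclic.exists_generator (α := Kˣ)
  have hord : orderOf g = Fintype.card K - 1 := by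
    rw [orderOf_eq_card_of_forall_mem_zpowers hg, Nat.card_eq_fintype_card, Fintype.card_units]
  obtain ⟨c, hc⟩ := h
  have h1 : IsPrimitiveRoot (g : K) (Fintype.card K - 1) := by
    rw [← hord, ← orderOf_units]; exact IsPrimitiveRoot.orderOf _
  have : 1 < Fintype.card K := Fintype.one_lt_card
  exact ⟨(g : K) ^ c, h1.pow (by omega) (by rw [hc, mul_comm])⟩

lemma aux_pow_iff {K : Type*} [Field K] (s : K) (d : ℕ) :
    s ^ (d + 1) = s ↔ s = 0 ∨ s ^ d = 1 := by
  constructor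
  · intro h
    by_cases h0 : s = 0
    · exact Or.inl h0
    · right
      rw [pow_succ] at h
      exact mul_right_cancel₀ h0 (by rw [h, one_mul])
  · rintro (h | h)
    · rw [h, zero_pow (Nat.succ_ne_zero d)]
    · rw [pow_succ, h, one_mul]

lemma aux_set {K : Type*} [Field K] [Fintype K] [DecidableEq K] (N v d : ℕ) (hN : 0 < N)
    (hvd : d * v = N) (h : N ∣ Fintype.card K - 1) :
    (Finset.univ.filter (fun c : K => c ^ (N + 1) = c)).image (fun u => u ^ v) =
      Finset.univ.filter (fun s : K => s ^ (d + 1) = s) := by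
  have hv : 0 < v := Nat.pos_of_ne_zero (by rintro rfl; omega)
  have hd : 0 < d := Nat.pos_of_ne_zero (by rintro rfl; omega)
  ext s
  simp only [Finset.mem_image, Finset.mem_filter, Finset.mem_univ, true_and, aux_pow_iff]
  constructor
  · rintro ⟨u, hu | hu, rfl⟩
    · left; rw [hu, zero_pow hv.ne']
    · right; rw [← pow_mul, mul_comm, hvd, hu]
  · rintro (hs | hs)
    · exact ⟨0, Or.inl rfl, by rw [hs, zero_pow hv.ne']⟩
    · obtain ⟨u, hu, hus⟩ := aux_cyc d v hv hd (by rw [hvd]; exact h) s hs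
      exact ⟨u, Or.inr (by rw [← hvd]; exact hu), hus⟩

lemma aux_setcard {K : Type*} [Field K] [Fintype K] [DecidableEq K] (d : ℕ) (hd : 0 < d)
    (h : d ∣ Fintype.card K - 1) :
    (Finset.univ.filter (fun s : K => s ^ (d + 1) = s)).card = d + 1 := by
  obtain ⟨z, hz⟩ := aux_prim d h
  have : Finset.univ.filter (fun s : K => s ^ (d + 1) = s) =
      insert 0 (nthRootsFinset d (1 : K)) := by
    ext s
    simp only [Finset.mem_filter, Finset.mem_univ, true_and, aux_pow_iff, Finset.mem_insert,
      mem_nthRootsFinset hd]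
  rw [this, Finset.card_insert_of_notMem, hz.card_nthRootsFinset]
  rw [mem_nthRootsFinset hd, zero_pow hd.ne']
  exact zero_ne_one

lemma aux_count {K : Type*} [Field K] [Fintype K] [DecidableEq K] (f : K[X])
    (hD : 0 < f.natDegree) : Fintype.card K ≤ f.natDegree * (valueSet f).card := by
  rw [← Finset.card_univ]
  apply Finset.card_le_mul_card_image
  intro b _
  refine (aux_card_le _ (f - C b) ?_ ?_).trans (le_of_eq (natDegree_sub_C))
  · intro h
    have : (f - C b).natDegree = 0 := by rw [h, natDegree_zero]
    rw [natDegree_sub_C] at this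
    omega
  · intro a ha
    rw [eval_sub, eval_C, (Finset.mem_filter.mp ha).2, sub_self]

lemma aux_mem {K : Type*} [Field K] [Fintype K] [DecidableEq K] (d : ℕ) (hd : 0 < d)
    (h : d ∣ Fintype.card K - 1) (f : K[X]) (hD : 0 < f.natDegree) :
    f ∈ MVSPset (Finset.univ.filter (fun s : K => s ^ (d + 1) = s)) ↔
      (f.natDegree * d ≤ Fintype.card K - 1 ∧ ∀ a, f.eval a ^ (d + 1) = f.eval a) := by
  have hc := aux_setcard d hd h
  have hq : 1 < Fintype.card K := Fintype.one_lt_card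
  constructor
  · rintro ⟨⟨_, h1⟩, h2⟩
    constructor
    · rw [h2, hc] at h1
      have h3 : d = (Fintype.card K - 1) / f.natDegree := by omega
      rw [h3]; exact Nat.mul_div_le _ _
    · intro a
      have : f.eval a ∈ valueSet f := Finset.mem_image_of_mem _ (Finset.mem_univ a)
      rw [h2] at this
      exact (Finset.mem_filter.mp this).2
  · rintro ⟨h1, h2⟩
    have hsub : valueSet f ⊆ Finset.univ.filter (fun s : K => s ^ (d + 1) = s) := by
      intro x hx
      obtain ⟨a, _, rfl⟩ := Finset.mem_image.mp hx
      exact Finset.mem_filter.mpr ⟨Finset.mem_univ _, h2 a⟩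
    have h3 := aux_count f hD
    have h4 : d < (valueSet f).card := by
      apply Nat.lt_of_mul_lt_mul_left (a := f.natDegree)
      omega
    have h5 : valueSet f = _ := Finset.eq_of_subset_of_card_le hsub (by omega)
    refine ⟨⟨hD, ?_⟩, h5⟩
    rw [h5, hc]
    congr 1
    symm
    rw [h5, hc] at h3
    apply Nat.div_eq_of_lt_le
    · rw [mul_comm]; exact h1
    · rw [mul_comm]; omega

lemma aux_final {K : Type*} [Field K] [Fintype K] [DecidableEq K] (p : ℕ) [Fact p.Prime]
    [CharP K p] (hcard : Fintype.card K = p ^ 4) (d t e : ℕ) (hd : 2 ≤ d) (he : e ∣ 4)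
    (htd : t * d = p ^ e - 1) (hmin : ∀ s, 0 < s → s < e → ¬ d ∣ p ^ s - 1) :
    MVSPset (Finset.univ.filter (fun s : K => s ^ (d + 1) = s)) =
      {g | ∃ f ∈ MVSPset (Finset.univ.filter (fun c : K => c ^ p ^ e = c)), g = f ^ t} := by
  have hp : p.Prime := Fact.out
  have he0 : 0 < e := Nat.pos_of_dvd_of_pos he (by norm_num)
  have hpe : 1 < p ^ e := Nat.one_lt_pow he0.ne' hp.one_lt
  have hN : p ^ e - 1 ∣ Fintype.card K - 1 := by
    rw [hcard]; exact Nat.pow_sub_one_dvd_pow_sub_one p he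
  have hdN : d ∣ Fintype.card K - 1 := (Dvd.intro_left t htd).trans hN
  have ht0 : 0 < t := Nat.pos_of_ne_zero (by rintro rfl; omega)
  have hpe' : p ^ e = (p ^ e - 1) + 1 := by omega
  have hset : Finset.univ.filter (fun c : K => c ^ p ^ e = c) =
      Finset.univ.filter (fun c : K => c ^ ((p ^ e - 1) + 1) = c) := by rw [← hpe']
  rw [hset]
  ext f
  constructor
  · intro hf
    have hD := hf.1.1
    have hval := hf.2
    obtain ⟨hDd, hfe⟩ := (aux_mem d (by omega) hdN f hD).mp hf
    have hex : ∀ x : K, x ^ (d + 1) = x → ∃ a, f.eval a = x := by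
      intro x hx
      have : x ∈ valueSet f := by rw [hval]; simpa using hx
      obtain ⟨a, _, ha⟩ := Finset.mem_image.mp this
      exact ⟨a, ha⟩
    have hz : ∃ a, f.eval a = 0 := hex 0 (zero_pow (by omega))
    obtain ⟨a1, ha1⟩ := hex 1 (one_pow _)
    obtain ⟨c, g, hcg⟩ : ∃ c g, f = C c * g ^ t := by
      rcases aux_div4 e he with h1 | h1
      · subst h1
        rw [pow_one] at htd
        exact aux_1 p hcard f d t hd hD hDd hfe htd
      · exact aux_24 p hcard f d t e hd hD hDd hfe hz h1 htd hmin
    have hg1 : c * g.eval a1 ^ t = 1 := by rw [← ha1, hcg]; simp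
    have hg0 : g.eval a1 ≠ 0 := by
      intro h0
      rw [h0, zero_pow ht0.ne', mul_zero] at hg1
      exact zero_ne_one hg1
    have hf1 : f = (C (g.eval a1)⁻¹ * g) ^ t := by
      rw [mul_pow, ← C_pow, hcg, inv_pow]
      congr 2
      exact eq_inv_of_mul_eq_one_left hg1
    set f1 := C (g.eval a1)⁻¹ * g with hf1d
    have hdeg : f.natDegree = t * f1.natDegree := by rw [hf1, natDegree_pow]
    have hD1 : 0 < f1.natDegree := Nat.pos_of_ne_zero (by intro h; rw [h] at hdeg; omega)
    refine ⟨f1, (aux_mem (p ^ e - 1) (by omega) hN f1 hD1).mpr ⟨?_, ?_⟩, hf1⟩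
    · rw [← htd]
      calc f1.natDegree * (t * d) = f.natDegree * d := by rw [hdeg]; ring
        _ ≤ _ := hDd
    · intro a
      have := hfe a
      rw [hf1, eval_pow, aux_pow_iff] at this
      rw [aux_pow_iff]
      rcases this with h | h
      · left; exact pow_eq_zero_iff ht0.ne' |>.mp h
      · right; rw [← htd, pow_mul]; exact h
  · rintro ⟨f1, hf1, rfl⟩
    have hD1 := hf1.1.1
    obtain ⟨h1, h2⟩ := (aux_mem (p ^ e - 1) (by omega) hN f1 hD1).mp hf1
    have hdeg : (f1 ^ t).natDegree = t * f1.natDegree := natDegree_pow _ _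
    refine (aux_mem d (by omega) hdN _ (by rw [hdeg]; positivity)).mpr ⟨?_, ?_⟩
    · rw [hdeg]
      calc t * f1.natDegree * d = f1.natDegree * (t * d) := by ring
        _ ≤ _ := by rw [htd]; exact h1
    · intro a
      have := h2 a
      rw [aux_pow_iff] at this
      rw [eval_pow, aux_pow_iff]
      rcases this with h | h
      · left; rw [h, zero_pow ht0.ne']
      · right; rw [← pow_mul, htd]; exact h

/-- the conjecture holds for `q = p^4` in the case where `U = 𝔽_{p^{mk}}` is a
subfield: `𝒫(U^v, p^4) = {f^t : f ∈ 𝒫(𝔽_{p^e}, p^4)}`. -/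
theorem stmt_8 (p k v m e t : ℕ) (hp : p.Prime) (hk : k ∣ 4)
    (hv : 0 < v) (hvd : v ∣ p ^ k - 1) (hm : 0 < m) (hmk : m * k ∣ 4)
    (F : Type) [Field F] [Fintype F] [DecidableEq F]
    (hcard : Fintype.card F = p ^ 4)
    (U : Finset F) (hUdef : U = Finset.univ.filter (fun c : F => c ^ p ^ (m * k) = c))
    (hUv : 2 < (U.image (fun u => u ^ v)).card)
    (he : 0 < e) (heU : ∀ s ∈ U.image (fun u => u ^ v), s ^ p ^ e = s)
    (hemin : ∀ e', 0 < e' → (∀ s ∈ U.image (fun u => u ^ v), s ^ p ^ e' = s) → e ≤ e')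
    (ht : t * (p ^ (m * k) - 1) = v * (p ^ e - 1)) :
    MVSPset (U.image (fun u => u ^ v)) =
      {g | ∃ f ∈ MVSPset (Finset.univ.filter (fun c : F => c ^ p ^ e = c)), g = f ^ t} := by
  haveI : Fact p.Prime := ⟨hp⟩
  haveI : CharP F p := charP_of_card_eq_prime_pow hcard
  have hk0 : 0 < k := Nat.pos_of_dvd_of_pos hk (by norm_num)
  have hn0 : 0 < m * k := Nat.mul_pos hm hk0
  have hpn : 1 < p ^ (m * k) := Nat.one_lt_pow hn0.ne' hp.one_lt
  have hpe : 1 < p ^ e := Nat.one_lt_pow he.ne' hp.one_lt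
  have hNq : p ^ (m * k) - 1 ∣ Fintype.card F - 1 := by
    rw [hcard]; exact Nat.pow_sub_one_dvd_pow_sub_one p hmk
  obtain ⟨d, hd⟩ : v ∣ p ^ (m * k) - 1 :=
    hvd.trans (Nat.pow_sub_one_dvd_pow_sub_one p (Dvd.intro_left m rfl))
  have hd0 : 0 < d := Nat.pos_of_ne_zero (by rintro rfl; omega)
  have hdn : d ∣ p ^ (m * k) - 1 := Dvd.intro_left v hd.symm
  have hdq := hdn.trans hNq
  have hS : U.image (fun u => u ^ v) = Finset.univ.filter (fun s : F => s ^ (d + 1) = s) := by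
    rw [← aux_set (p ^ (m * k) - 1) v d (by omega) (by rw [hd, mul_comm]) hNq,
      Nat.sub_add_cancel hpn.le, hUdef]
  rw [hS] at hUv heU hemin ⊢
  rw [aux_setcard d hd0 hdq] at hUv
  have htd : t * d = p ^ e - 1 := by
    rw [hd] at ht
    apply Nat.eq_of_mul_eq_mul_left hv
    rw [← ht]; ring
  have hmin : ∀ s, 0 < s → d ∣ p ^ s - 1 → e ≤ s := by
    intro s hs hds
    apply hemin s hs
    intro x hx
    have hx' := (Finset.mem_filter.mp hx).2
    have hps : 1 < p ^ s := Nat.one_lt_pow hs.ne' hp.one_lt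
    have h1 : p ^ s = (p ^ s - 1) + 1 := by omega
    rw [h1, aux_pow_iff]
    rw [aux_pow_iff] at hx'
    rcases hx' with h | h
    · exact Or.inl h
    · right
      obtain ⟨c, hc⟩ := hds
      rw [hc, pow_mul, h, one_pow]
  have hde : d ∣ p ^ e - 1 := Dvd.intro_left t htd
  have hen : e ∣ m * k := by
    have h1 : d ∣ p ^ (Nat.gcd e (m * k)) - 1 := by
      rw [← Nat.pow_sub_one_gcd_pow_sub_one]
      exact Nat.dvd_gcd hde hdn
    have h2 := hmin _ (Nat.gcd_pos_of_pos_left _ he) h1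
    have h3 := Nat.le_of_dvd he (Nat.gcd_dvd_left e (m * k))
    have h4 : Nat.gcd e (m * k) = e := le_antisymm h3 h2
    rw [← h4]
    exact Nat.gcd_dvd_right _ _
  exact aux_final p hcard d t e (by omega) (hen.trans hmk) htd
    (fun s hs hse hds => absurd (hmin s hs hds) (by omega))
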